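/- Let D ≥ 1, let n : Fin D → ℕ give mode sizes, and let X, Y be order-D real tensors of size n 1 × ⋯ × n D. Then ⟨X, Y⟩ ≤ (1/D) · ∑_{d=1}^{D} ∑_{k=1}^{n d} σ^(d)_k(X) · σ^(d)_k(Y); equivalently, ⟨X, Y⟩ ≤ ⟨σ(X), σ(Y)⟩ where σ(Z) denotes the vector (1/√D)·(σ^(1)(Z), …, σ^(D)(Z)) obtained by concatenating all mode-d singular spectra and scaling by 1/√D. -/

import Mathlib

open scoped BigOperators Matrix

/-- The entries of `v` sorted in nonincreasing order. -/
noncomputable def sortDesc {m : ℕ} (v : Fin m → ℝ) : Fin m → ℝ :=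
  fun k => (v ∘ Tuple.sort v) k.rev

theorem gram_isHermitian {m : ℕ} {J : Type*} [Fintype J]
    (A : Matrix (Fin m) J ℝ) : (A * Aᵀ).IsHermitian := by
  ext i j
  simp [Matrix.conjTranspose_apply, Matrix.mul_apply, Matrix.transpose_apply, mul_comm]

/-- Singular values of a real matrix `A`: the square roots of the eigenvalues of
the positive semidefinite matrix `A * Aᵀ`, in nonincreasing order. -/
noncomputable def singularValues {m : ℕ} {J : Type*} [Fintype J]
    (A : Matrix (Fin m) J ℝ) : Fin m → ℝ :=
  fun k => Real.sqrt (sortDesc (gram_isHermitian A).eigenvalues k)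

variable {D : ℕ} {n : Fin D → ℕ}

/-- Inner product of two tensors. -/
noncomputable def tinner (X Y : (∀ d, Fin (n d)) → ℝ) : ℝ :=
  ∑ i : ∀ d, Fin (n d), X i * Y i

/-- Mode-`d` matricization of the tensor `X`. -/
def matricize (X : (∀ d, Fin (n d)) → ℝ) (d : Fin D) :
    Matrix (Fin (n d)) (∀ d' : {d' : Fin D // d' ≠ d}, Fin (n d')) ℝ :=
  Matrix.of fun k j =>
    X (fun d' => if h : d' = d then Fin.cast (congrArg n h.symm) k else j ⟨d', h⟩)

/-- Mode-`d` singular values of a tensor. -/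
noncomputable def modeSV (X : (∀ d, Fin (n d)) → ℝ) (d : Fin D) : Fin (n d) → ℝ :=
  singularValues (matricize X d)

/-- The multilinear (Tucker) product `X ×₁ U 1 ×₂ ⋯ ×_D U D`. -/
noncomputable def tuckerMul (X : (∀ d, Fin (n d)) → ℝ)
    (U : ∀ d, Matrix (Fin (n d)) (Fin (n d)) ℝ) : (∀ d, Fin (n d)) → ℝ :=
  fun i => ∑ j : ∀ d, Fin (n d), (∏ d, U d (i d) (j d)) * X j

/-- Rectangular "diagonal" matrix with columns indexed by an arbitrary fintype,
identified with an initial segment of `ℕ` via `Fintype.equivFin`. -/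
noncomputable def rectDiagJ {m : ℕ} {J : Type*} [Fintype J]
    (v : Fin m → ℝ) : Matrix (Fin m) J ℝ :=
  Matrix.of fun k j => if ((Fintype.equivFin J) j : ℕ) = (k : ℕ) then v k else 0

theorem sortDesc_antitone {m : ℕ} (v : Fin m → ℝ) : Antitone (sortDesc v) := fun _ _ h =>
  Tuple.monotone_sort v (Fin.rev_le_rev.mpr h)

theorem singularValues_antitone {m : ℕ} {J : Type*} [Fintype J] (A : Matrix (Fin m) J ℝ) :
    Antitone (singularValues A) := fun _ _ h =>
  Real.sqrt_le_sqrt (sortDesc_antitone _ h)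

theorem singularValues_nonneg {m : ℕ} {J : Type*} [Fintype J] (A : Matrix (Fin m) J ℝ)
    (k : Fin m) : 0 ≤ singularValues A k :=
  Real.sqrt_nonneg _

/-- A bilinear form with doubly substochastic coefficients, evaluated at nonincreasing
nonnegative vectors, is at most their inner product. -/
theorem sum_mul_le_of_doublySubstochastic {m : ℕ} (s t : Fin m → ℝ) (M : Fin m → Fin m → ℝ)
    (hs : Antitone s) (ht : Antitone t) (hs0 : ∀ i, 0 ≤ s i) (ht0 : ∀ i, 0 ≤ t i)
    (hM : ∀ i j, 0 ≤ M i j) (hrow : ∀ i, ∑ j, M i j ≤ 1) (hcol : ∀ j, ∑ i, M i j ≤ 1) :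
    ∑ i, ∑ j, s i * t j * M i j ≤ ∑ i, s i * t i := by
  induction m with
  | zero => simp
  | succ m ih =>
    set c := s (Fin.last m)
    set d := t (Fin.last m)
    have hc : ∀ i, 0 ≤ s i - c := fun i => sub_nonneg.mpr (hs (Fin.le_last i))
    have hd : ∀ i, 0 ≤ t i - d := fun i => sub_nonneg.mpr (ht (Fin.le_last i))
    have ih' := ih (fun i => s i.castSucc - c) (fun i => t i.castSucc - d)
      (fun i j => M i.castSucc j.castSucc)
      (fun i j h => sub_le_sub_right (hs (Fin.castSucc_le_castSucc_iff.mpr h)) _)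
      (fun i j h => sub_le_sub_right (ht (Fin.castSucc_le_castSucc_iff.mpr h)) _)
      (fun i => hc _) (fun i => hd _) (fun i j => hM _ _)
      (fun i => by
        have h := hrow i.castSucc
        rw [Fin.sum_univ_castSucc] at h
        linarith [hM i.castSucc (Fin.last m)])
      (fun j => by
        have h := hcol j.castSucc
        rw [Fin.sum_univ_castSucc] at h
        linarith [hM (Fin.last m) j.castSucc])
    have hcore : ∑ i, ∑ j, (s i - c) * (t j - d) * M i j ≤ ∑ i, (s i - c) * (t i - d) := by
      simpa [Fin.sum_univ_castSucc, c, d] using ih'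
    have hrows : ∑ i, (s i - c) * ∑ j, M i j ≤ ∑ i, (s i - c) :=
      Finset.sum_le_sum fun i _ => mul_le_of_le_one_right (hc i) (hrow i)
    have hcols : ∑ j, t j * ∑ i, M i j ≤ ∑ j, t j :=
      Finset.sum_le_sum fun j _ => mul_le_of_le_one_right (ht0 j) (hcol j)
    have hsplit : ∑ i, ∑ j, s i * t j * M i j =
        ∑ i, ∑ j, (s i - c) * (t j - d) * M i j + d * ∑ i, (s i - c) * ∑ j, M i j +
          c * ∑ j, t j * ∑ i, M i j := by
      simp only [Finset.mul_sum]
      rw [Finset.sum_comm (s := Finset.univ) (t := Finset.univ)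
        (f := fun j i => c * (t j * M i j))]
      simp only [← Finset.sum_add_distrib]
      exact Finset.sum_congr rfl fun i _ => Finset.sum_congr rfl fun j _ => by ring
    have hdiag : ∑ i, s i * t i =
        ∑ i, (s i - c) * (t i - d) + d * ∑ i, (s i - c) + c * ∑ j, t j := by
      simp only [Finset.mul_sum, ← Finset.sum_add_distrib]
      exact Finset.sum_congr rfl fun i _ => by ring
    rw [hsplit, hdiag]
    gcongr
    · exact ht0 _
    · exact hs0 _

/-- Bessel's inequality for the rows of `F`, which are orthogonal and of norm at most one. -/
theorem bessel_of_mul_transpose_eq_diagonal {m : ℕ} {J : Type*} [Fintype J]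
    {F : Matrix (Fin m) J ℝ} {p : Fin m → ℝ} (hp : ∀ i, p i ≤ 1)
    (hF : F * Fᵀ = Matrix.diagonal p) (e : J → ℝ) :
    ∑ j, (F *ᵥ e) j ^ 2 ≤ e ⬝ᵥ e := by
  have hpos : 0 ≤ (e - (F *ᵥ e) ᵥ* F) ⬝ᵥ (e - (F *ᵥ e) ᵥ* F) :=
    Finset.sum_nonneg fun i _ => mul_self_nonneg _
  have hcross : (F *ᵥ e) ᵥ* F ⬝ᵥ e = ∑ j, (F *ᵥ e) j ^ 2 := by
    rw [← Matrix.dotProduct_mulVec]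
    simp [dotProduct, sq]
  have hquad : (F *ᵥ e) ᵥ* F ⬝ᵥ (F *ᵥ e) ᵥ* F = ∑ j, p j * (F *ᵥ e) j ^ 2 := by
    rw [← Matrix.dotProduct_mulVec, ← Matrix.mulVec_transpose F, Matrix.mulVec_mulVec, hF]
    simp only [dotProduct, Matrix.mulVec_diagonal]
    exact Finset.sum_congr rfl fun i _ => by ring
  have hle : ∑ j, p j * (F *ᵥ e) j ^ 2 ≤ ∑ j, (F *ᵥ e) j ^ 2 :=
    Finset.sum_le_sum fun j _ => mul_le_of_le_one_left (sq_nonneg _) (hp j)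
  rw [sub_dotProduct, dotProduct_sub, dotProduct_sub, dotProduct_comm e ((F *ᵥ e) ᵥ* F), hcross, hquad] at hpos
  linarith

theorem sum_sq_mul_transpose_row_le_one {m : ℕ} {J : Type*} [Fintype J]
    {E F : Matrix (Fin m) J ℝ} {p q : Fin m → ℝ} (hp : ∀ i, p i ≤ 1) (hq : ∀ i, q i ≤ 1)
    (hE : E * Eᵀ = Matrix.diagonal p) (hF : F * Fᵀ = Matrix.diagonal q) (i : Fin m) :
    ∑ j, (E * Fᵀ) i j ^ 2 ≤ 1 := by
  have h := bessel_of_mul_transpose_eq_diagonal hq hF (E i)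
  have hEi : E i ⬝ᵥ E i = p i := by
    simpa [Matrix.mul_apply, dotProduct] using congrFun (congrFun hE i) i
  calc ∑ j, (E * Fᵀ) i j ^ 2 = ∑ j, (F *ᵥ E i) j ^ 2 := by
        simp [Matrix.mul_apply, Matrix.mulVec, dotProduct, mul_comm]
    _ ≤ 1 := h.trans (hEi.trans_le (hp i))

theorem sum_sq_mul_transpose_col_le_one {m : ℕ} {J : Type*} [Fintype J]
    {E F : Matrix (Fin m) J ℝ} {p q : Fin m → ℝ} (hp : ∀ i, p i ≤ 1) (hq : ∀ i, q i ≤ 1)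
    (hE : E * Eᵀ = Matrix.diagonal p) (hF : F * Fᵀ = Matrix.diagonal q) (j : Fin m) :
    ∑ i, (E * Fᵀ) i j ^ 2 ≤ 1 := by
  have h := sum_sq_mul_transpose_row_le_one hq hp hF hE j
  simpa [Matrix.mul_apply, mul_comm] using h

/-- An orthogonal matrix whose columns are eigenvectors of `A * Aᵀ`, ordered by nonincreasing
eigenvalue. -/
theorem exists_orthogonal_gram_diagonal {m : ℕ} {J : Type*} [Fintype J]
    (A : Matrix (Fin m) J ℝ) :
    ∃ U : Matrix (Fin m) (Fin m) ℝ, Uᵀ * U = 1 ∧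
      (Uᵀ * A) * (Uᵀ * A)ᵀ = Matrix.diagonal fun k => singularValues A k ^ 2 := by
  have hA := gram_isHermitian A
  let e : Fin m ≃ Fin m := Fin.revPerm.trans (Tuple.sort hA.eigenvalues)
  let W : Matrix (Fin m) (Fin m) ℝ := hA.eigenvectorUnitary
  have hW : Wᵀ * W = 1 := by
    have h := Unitary.coe_star_mul_self hA.eigenvectorUnitary
    rwa [Matrix.star_eq_conjTranspose, Matrix.conjTranspose_eq_transpose_of_trivial] at h
  have hWA : Wᵀ * (A * Aᵀ) * W = Matrix.diagonal hA.eigenvalues := by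
    have h := hA.spectral_theorem
    rw [Unitary.conjStarAlgAut_apply, Matrix.star_eq_conjTranspose,
      Matrix.conjTranspose_eq_transpose_of_trivial] at h
    change A * Aᵀ = W * _ * Wᵀ at h
    calc Wᵀ * (A * Aᵀ) * W
        = Wᵀ * (W * Matrix.diagonal (RCLike.ofReal ∘ hA.eigenvalues) * Wᵀ) * W :=
          congrArg (fun G => Wᵀ * G * W) h
      _ = (Wᵀ * W) * Matrix.diagonal (RCLike.ofReal ∘ hA.eigenvalues) * (Wᵀ * W) := by
          simp only [Matrix.mul_assoc]
      _ = _ := by simp only [hW, Matrix.mul_one, Matrix.one_mul]; rfl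
  have hnonneg : ∀ i, 0 ≤ hA.eigenvalues i := by
    have hpsd : (A * Aᵀ).PosSemidef := by
      simpa [Matrix.conjTranspose_eq_transpose_of_trivial] using
        Matrix.posSemidef_self_mul_conjTranspose A
    exact hpsd.eigenvalues_nonneg
  refine ⟨W.submatrix id e, ?_, ?_⟩
  · rw [Matrix.transpose_submatrix, Matrix.submatrix_mul _ _ _ _ _ Function.bijective_id |>.symm,
      hW, Matrix.submatrix_one_equiv]
  · have hsub : (W.submatrix id e)ᵀ * A = (Wᵀ * A).submatrix e id := by
      ext i j
      simp [Matrix.mul_apply]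
    have hgram : (Wᵀ * A) * (Wᵀ * A)ᵀ = Matrix.diagonal hA.eigenvalues := by
      rw [← hWA, Matrix.transpose_mul, Matrix.transpose_transpose]
      simp only [Matrix.mul_assoc]
    rw [hsub, Matrix.transpose_submatrix,
      ← Matrix.submatrix_mul _ _ _ _ _ Function.bijective_id, hgram,
      Matrix.submatrix_diagonal_equiv]
    congr 1
    ext k
    exact (Real.sq_sqrt (hnonneg (e k))).symm

/-- Singular value decomposition, with the right factor having orthogonal rows of norm
zero or one. -/
theorem exists_svd {m : ℕ} {J : Type*} [Fintype J] (A : Matrix (Fin m) J ℝ) :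
    ∃ (U : Matrix (Fin m) (Fin m) ℝ) (E : Matrix (Fin m) J ℝ) (p : Fin m → ℝ),
      Uᵀ * U = 1 ∧ (∀ i, p i ≤ 1) ∧ E * Eᵀ = Matrix.diagonal p ∧
        A = U * (Matrix.diagonal (singularValues A) * E) := by
  obtain ⟨U, hU, hC⟩ := exists_orthogonal_gram_diagonal A
  set C := Uᵀ * A with hCdef
  set σ := singularValues A
  refine ⟨U, Matrix.diagonal (fun i => (σ i)⁻¹) * C, fun i => (σ i)⁻¹ * σ i ^ 2 * (σ i)⁻¹,
    hU, fun i => ?_, ?_, ?_⟩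
  · rcases eq_or_ne (σ i) 0 with h | h
    · simp [h]
    · exact le_of_eq (by field_simp)
  · rw [Matrix.transpose_mul, Matrix.diagonal_transpose, Matrix.mul_assoc, ← Matrix.mul_assoc C,
      hC, Matrix.diagonal_mul_diagonal, Matrix.diagonal_mul_diagonal]
    simp only [mul_assoc]
  · have hCσ : Matrix.diagonal σ * (Matrix.diagonal (fun i => (σ i)⁻¹) * C) = C := by
      ext i j
      rw [Matrix.diagonal_mul, Matrix.diagonal_mul]
      rcases eq_or_ne (σ i) 0 with h | h
      · have hrow : ∑ j, C i j * C i j = 0 := by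
          simpa [Matrix.mul_apply, h] using congrFun (congrFun hC i) i
        have hij := (Finset.sum_eq_zero_iff_of_nonneg fun j _ => mul_self_nonneg (C i j)).mp
          hrow j (Finset.mem_univ j)
        simp [mul_self_eq_zero.mp hij]
      · field_simp
    rw [hCσ, hCdef, ← Matrix.mul_assoc, mul_eq_one_comm.mp hU, Matrix.one_mul]

/-- Von Neumann's trace inequality for rectangular real matrices. -/
theorem trace_mul_transpose_le_sum_singularValues {m : ℕ} {J : Type*} [Fintype J]
    (A B : Matrix (Fin m) J ℝ) :
    (A * Bᵀ).trace ≤ ∑ k, singularValues A k * singularValues B k := by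
  obtain ⟨U, E, p, hU, hp, hE, hA⟩ := exists_svd A
  obtain ⟨V, F, q, hV, hq, hF, hB⟩ := exists_svd B
  set σ := singularValues A
  set τ := singularValues B
  set P := Uᵀ * Vᵀᵀ with hP
  set Q := E * Fᵀ with hQ
  have hU' : Uᵀ * Uᵀᵀ = Matrix.diagonal fun _ => 1 := by simpa using hU
  have hV' : Vᵀ * Vᵀᵀ = Matrix.diagonal fun _ => 1 := by simpa using hV
  have htrace : (A * Bᵀ).trace = ∑ i, ∑ j, σ i * τ j * (P i j * Q i j) := by
    have h : (A * Bᵀ).trace =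
        ((Matrix.diagonal σ * Q * Matrix.diagonal τ) * Pᵀ).trace := by
      rw [hA, hB, hP, hQ]
      simp only [Matrix.transpose_mul, Matrix.transpose_transpose, Matrix.diagonal_transpose,
        Matrix.mul_assoc]
      rw [Matrix.trace_mul_comm]
      simp only [Matrix.mul_assoc]
    rw [h]
    simp only [Matrix.trace, Matrix.diag, Matrix.mul_apply (M := _ * _ * _),
      Matrix.mul_diagonal, Matrix.diagonal_mul, Matrix.transpose_apply]
    exact Finset.sum_congr rfl fun i _ => Finset.sum_congr rfl fun j _ => by ring
  rw [htrace]
  calc ∑ i, ∑ j, σ i * τ j * (P i j * Q i j)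
      ≤ ∑ i, ∑ j, σ i * τ j * ((P i j ^ 2 + Q i j ^ 2) / 2) := by
        gcongr with i _ j _
        · exact mul_nonneg (singularValues_nonneg A i) (singularValues_nonneg B j)
        · linarith [two_mul_le_add_sq (P i j) (Q i j)]
    _ ≤ ∑ k, σ k * τ k := by
        refine sum_mul_le_of_doublySubstochastic σ τ _ (singularValues_antitone A)
          (singularValues_antitone B) (singularValues_nonneg A) (singularValues_nonneg B)
          (fun i j => by positivity) (fun i => ?_) (fun j => ?_)
        · rw [← Finset.sum_div, Finset.sum_add_distrib]
          linarith [sum_sq_mul_transpose_row_le_one (fun _ => le_rfl) (fun _ => le_rfl) hU' hV' i,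
            sum_sq_mul_transpose_row_le_one hp hq hE hF i]
        · rw [← Finset.sum_div, Finset.sum_add_distrib]
          linarith [sum_sq_mul_transpose_col_le_one (fun _ => le_rfl) (fun _ => le_rfl) hU' hV' j,
            sum_sq_mul_transpose_col_le_one hp hq hE hF j]

theorem tinner_eq_trace_matricize {D : ℕ} {n : Fin D → ℕ} (X Y : (∀ d, Fin (n d)) → ℝ)
    (d : Fin D) : tinner X Y = (matricize X d * (matricize Y d)ᵀ).trace := by
  have hmat : ∀ (Z : (∀ d, Fin (n d)) → ℝ) k j,
      matricize Z d k j = Z ((Equiv.piSplitAt d fun d => Fin (n d)).symm (k, j)) := by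
    intro Z k j
    refine congrArg Z (funext fun d' => ?_)
    by_cases h : d' = d
    · subst h
      simp
    · simp [h]
  simp only [Matrix.trace, Matrix.diag, Matrix.mul_apply, Matrix.transpose_apply, hmat]
  rw [← Fintype.sum_prod_type']
  exact (Equiv.sum_comp (Equiv.piSplitAt d fun d => Fin (n d)).symm
    fun i => X i * Y i).symm

/-- von Neumann's inequality for tensors, averaged form. -/
theorem vonNeumann_tensor_averaged (D : ℕ) (hD : 1 ≤ D) (n : Fin D → ℕ)
    (X Y : (∀ d, Fin (n d)) → ℝ) :
    tinner X Y ≤ (1 / (D : ℝ)) *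
      ∑ d : Fin D, ∑ k : Fin (n d), modeSV X d k * modeSV Y d k := by
  have hD' : (0 : ℝ) < D := by exact_mod_cast hD
  rw [one_div, inv_mul_eq_div, le_div_iff₀ hD']
  calc tinner X Y * D = ∑ _d : Fin D, tinner X Y := by simp [mul_comm]
    _ ≤ ∑ d : Fin D, ∑ k : Fin (n d), modeSV X d k * modeSV Y d k :=
        Finset.sum_le_sum fun d _ => (tinner_eq_trace_matricize X Y d).trans_le
          (trace_mul_transpose_le_sum_singularValues _ _)
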